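/- arXiv:2012.13845 — 8 statements merged into one kernel-verified Lean document; each statement's English description precedes it below -/
import Mathlib

section
/- Let ρ be a covariant ensemble and e a POVM, and let e◇ be the symmetrization of e. Then the success probabilities agree: P_S(e◇, ρ) = P_S(e, ρ). -/
open Matrix ComplexOrder

theorem symmetrization_success_probability {n M : ℕ} {G : Type} [Group G] [Fintype G]
    (U : G →* Matrix.unitaryGroup (Fin n) ℂ)
    (τ : G →* Equiv.Perm (Fin M))
    (ρ : Fin M → Matrix (Fin n) (Fin n) ℂ)
    (hρ_pos : ∀ m, (ρ m).PosSemidef)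
    (hρ_tr : ∑ m, (ρ m).trace = 1)
    (hρ_cov : ∀ (g : G) (m : Fin M),
      ρ (τ g m) = (U g : Matrix (Fin n) (Fin n) ℂ) * ρ m *
        ((U g : Matrix (Fin n) (Fin n) ℂ))ᴴ)
    (e : Fin M → Matrix (Fin n) (Fin n) ℂ)
    (he_pos : ∀ m, (e m).PosSemidef)
    (he_sum : ∑ m, e m = 1)
    (eSym : Fin M → Matrix (Fin n) (Fin n) ℂ)
    (heSym : ∀ m, eSym m = ((Fintype.card G : ℂ))⁻¹ •
      ∑ g : G, ((U g : Matrix (Fin n) (Fin n) ℂ))ᴴ * e (τ g m) *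
        (U g : Matrix (Fin n) (Fin n) ℂ)) :
    (∑ m, (ρ m * eSym m).trace).re = (∑ m, (ρ m * e m).trace).re := by
  have orbit_sum (g : G) : ∑ m, (ρ m * ((U g : Matrix (Fin n) (Fin n) ℂ)ᴴ * e (τ g m) *
      (U g : Matrix (Fin n) (Fin n) ℂ))).trace = ∑ m, (ρ m * e m).trace := by
    rw [← Equiv.sum_comp (τ g) fun m => (ρ m * e m).trace]
    refine Finset.sum_congr rfl fun m _ => ?_
    rw [hρ_cov, ← Matrix.mul_assoc, Matrix.trace_mul_comm]
    simp only [Matrix.mul_assoc]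
  have hcard : (Fintype.card G : ℂ) ≠ 0 := Nat.cast_ne_zero.mpr Fintype.card_ne_zero
  congr 1
  simp only [heSym, Matrix.mul_smul, Matrix.mul_sum, Matrix.trace_smul, Matrix.trace_sum,
    ← Finset.smul_sum]
  rw [Finset.sum_comm]
  simp only [orbit_sum, Finset.sum_const, Finset.card_univ, nsmul_eq_mul, smul_eq_mul]
  exact inv_mul_cancel_left₀ hcard _
end

section
/- (Theorem 1, quantum instantiation.) Let ρ be a covariant ensemble. Then for every POVM e there exists a covariant POVM e' such that P_S(e', ρ) = P_S(e, ρ). -/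
open Matrix ComplexOrder

section Twirl

variable {n M : ℕ} {G : Type} [Group G] [Fintype G]
  (U : G →* Matrix.unitaryGroup (Fin n) ℂ) (τ : G →* Equiv.Perm (Fin M))
  {e ρ : Fin M → Matrix (Fin n) (Fin n) ℂ}

/-- The group average of a family of matrices indexed by a set on which the group acts. -/
noncomputable def povmTwirl (e : Fin M → Matrix (Fin n) (Fin n) ℂ) (m : Fin M) :
    Matrix (Fin n) (Fin n) ℂ :=
  (Fintype.card G : ℂ)⁻¹ • ∑ g : G,
    (U g : Matrix (Fin n) (Fin n) ℂ)ᴴ * e (τ g m) * (U g : Matrix (Fin n) (Fin n) ℂ)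

theorem posSemidef_povmTwirl (he : ∀ m, (e m).PosSemidef) (m : Fin M) :
    (povmTwirl U τ e m).PosSemidef :=
  (Matrix.posSemidef_sum _ fun g _ => (he (τ g m)).conjTranspose_mul_mul_same _).smul
    (inv_nonneg.2 (Nat.cast_nonneg _))

theorem sum_povmTwirl (he : ∑ m, e m = 1) : ∑ m, povmTwirl U τ e m = 1 := by
  have h (g : G) : ∑ m, (U g : Matrix (Fin n) (Fin n) ℂ)ᴴ * e (τ g m) *
      (U g : Matrix (Fin n) (Fin n) ℂ) = 1 := by
    rw [← Finset.sum_mul, ← Finset.mul_sum, Equiv.sum_comp (τ g) e, he, mul_one]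
    exact Matrix.UnitaryGroup.star_mul_self (U g)
  simp only [povmTwirl]
  rw [← Finset.smul_sum, Finset.sum_comm, Finset.sum_congr rfl fun g _ => h g]
  rw [Finset.sum_const, Finset.card_univ, ← Nat.cast_smul_eq_nsmul ℂ,
    inv_smul_smul₀ (Nat.cast_ne_zero.2 Fintype.card_ne_zero)]

theorem povmTwirl_apply_perm (e : Fin M → Matrix (Fin n) (Fin n) ℂ) (g : G) (m : Fin M) :
    povmTwirl U τ e (τ g m) = (U g : Matrix (Fin n) (Fin n) ℂ) * povmTwirl U τ e m *
      (U g : Matrix (Fin n) (Fin n) ℂ)ᴴ := by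
  have hU : (U g : Matrix (Fin n) (Fin n) ℂ) * (U g : Matrix (Fin n) (Fin n) ℂ)ᴴ = 1 :=
    Unitary.coe_mul_star_self (U g)
  simp only [povmTwirl, Matrix.mul_smul, Matrix.smul_mul, Finset.mul_sum, Finset.sum_mul]
  congr 1
  refine Fintype.sum_equiv (Equiv.mulRight g) _ _ fun h => ?_
  simp only [Equiv.coe_mulRight, map_mul, Equiv.Perm.mul_apply, Submonoid.coe_mul,
    Matrix.conjTranspose_mul, Matrix.mul_assoc, hU, Matrix.mul_one]
  rw [← Matrix.mul_assoc (U g : Matrix (Fin n) (Fin n) ℂ), hU, Matrix.one_mul]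

theorem sum_trace_mul_povmTwirl
    (hρ : ∀ (g : G) (m : Fin M), ρ (τ g m) = (U g : Matrix (Fin n) (Fin n) ℂ) * ρ m *
      (U g : Matrix (Fin n) (Fin n) ℂ)ᴴ) (e : Fin M → Matrix (Fin n) (Fin n) ℂ) :
    ∑ m, (ρ m * povmTwirl U τ e m).trace = ∑ m, (ρ m * e m).trace := by
  have h (g : G) : ∑ m, (ρ m * ((U g : Matrix (Fin n) (Fin n) ℂ)ᴴ * e (τ g m) *
      (U g : Matrix (Fin n) (Fin n) ℂ))).trace = ∑ m, (ρ m * e m).trace := by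
    rw [← Equiv.sum_comp (τ g) fun m => (ρ m * e m).trace]
    refine Finset.sum_congr rfl fun m _ => ?_
    rw [hρ, ← Matrix.mul_assoc, Matrix.trace_mul_comm]
    simp only [Matrix.mul_assoc]
  simp only [povmTwirl, Matrix.mul_smul, Matrix.trace_smul, Finset.mul_sum, Matrix.trace_sum]
  simp only [← Finset.smul_sum]
  rw [Finset.sum_comm, Finset.sum_congr rfl fun g _ => h g]
  rw [Finset.sum_const, Finset.card_univ, ← Nat.cast_smul_eq_nsmul ℂ,
    inv_smul_smul₀ (Nat.cast_ne_zero.2 Fintype.card_ne_zero)]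

end Twirl

theorem exists_covariant_povm_same_success_probability
    {n M : ℕ} {G : Type} [Group G] [Fintype G]
    (U : G →* Matrix.unitaryGroup (Fin n) ℂ)
    (τ : G →* Equiv.Perm (Fin M))
    (ρ : Fin M → Matrix (Fin n) (Fin n) ℂ)
    (hρ_pos : ∀ m, (ρ m).PosSemidef)
    (hρ_tr : ∑ m, (ρ m).trace = 1)
    (hρ_cov : ∀ (g : G) (m : Fin M),
      ρ (τ g m) = (U g : Matrix (Fin n) (Fin n) ℂ) * ρ m *
        ((U g : Matrix (Fin n) (Fin n) ℂ))ᴴ)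
    (e : Fin M → Matrix (Fin n) (Fin n) ℂ)
    (he_pos : ∀ m, (e m).PosSemidef)
    (he_sum : ∑ m, e m = 1) :
    ∃ e' : Fin M → Matrix (Fin n) (Fin n) ℂ,
      (∀ m, (e' m).PosSemidef) ∧ (∑ m, e' m = 1) ∧
      (∀ (g : G) (m : Fin M),
        e' (τ g m) = (U g : Matrix (Fin n) (Fin n) ℂ) * e' m *
          ((U g : Matrix (Fin n) (Fin n) ℂ))ᴴ) ∧
      (∑ m, (ρ m * e' m).trace).re = (∑ m, (ρ m * e m).trace).re :=
  ⟨povmTwirl U τ e, posSemidef_povmTwirl U τ he_pos, sum_povmTwirl U τ he_sum,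
    povmTwirl_apply_perm U τ e, congrArg Complex.re (sum_trace_mul_povmTwirl U τ hρ_cov e)⟩
end

section
/- (Theorem 1 for a restricted class of measurements, quantum instantiation.) Let ℳ be a set of POVMs such that: (i) ℳ is convex, i.e., if e, e' ∈ ℳ and p is a real number with 0 ≤ p ≤ 1, then the family m ↦ p • e m + (1 - p) • e' m belongs to ℳ; (ii) ℳ is closed under permutations of the measurement outcomes, i.e., for every permutation σ : Equiv.Perm (Fin M) and every e ∈ ℳ, the family m ↦ e (σ m) belongs to ℳ; and (iii) for every g ∈ G and every e ∈ ℳ, the family m ↦ (U g)ᴴ * e m * (U g) belongs to ℳ. If ρ is a covariant ensemble, then for every e ∈ ℳ the symmetrization e◇ belongs to ℳ, is a covariant POVM, and satisfies P_S(e◇, ρ) = P_S(e, ρ). -/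
open Matrix ComplexOrder

/-- A sum of traces against a covariant family is unchanged when the other family is
transformed by conjugating and relabelling the outcomes. -/
theorem sum_trace_mul_conj_perm {ι κ R : Type*} [Fintype ι] [Fintype κ] [CommRing R] [StarRing R]
    (V : Matrix κ κ R) (σ : Equiv.Perm ι) (ρ e : ι → Matrix κ κ R)
    (hρ : ∀ m, ρ (σ m) = V * ρ m * Vᴴ) :
    ∑ m, (ρ m * (Vᴴ * e (σ m) * V)).trace = ∑ m, (ρ m * e m).trace := by
  rw [← Equiv.sum_comp σ fun m => (ρ m * e m).trace]
  refine Finset.sum_congr rfl fun m _ => ?_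
  rw [hρ, ← Matrix.mul_assoc, Matrix.trace_mul_comm]
  simp only [Matrix.mul_assoc]

/-- Summing the conjugates of a relabelled family over a finite group gives a covariant family. -/
theorem sum_conj_perm_covariant {ι κ R G : Type*} [Fintype κ] [DecidableEq κ] [CommRing R]
    [StarRing R] [Group G] [Fintype G] (U : G →* Matrix.unitaryGroup κ R) (τ : G →* Equiv.Perm ι)
    (e : ι → Matrix κ κ R) (h : G) (m : ι) :
    ∑ g, (U g : Matrix κ κ R)ᴴ * e (τ g (τ h m)) * (U g : Matrix κ κ R) =
      (U h : Matrix κ κ R) * (∑ g, (U g : Matrix κ κ R)ᴴ * e (τ g m) * (U g : Matrix κ κ R)) *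
        (U h : Matrix κ κ R)ᴴ := by
  have hU : (U h : Matrix κ κ R) * (U h : Matrix κ κ R)ᴴ = 1 :=
    Matrix.mem_unitaryGroup_iff.mp (U h).2
  symm
  rw [Finset.mul_sum, Finset.sum_mul, ← Equiv.sum_comp (Equiv.mulRight h)]
  refine Finset.sum_congr rfl fun g _ => ?_
  simp only [Equiv.coe_mulRight, map_mul, Equiv.Perm.mul_apply, Submonoid.coe_mul,
    Matrix.conjTranspose_mul]
  calc
    _ = (U h : Matrix κ κ R) * (U h : Matrix κ κ R)ᴴ *
          ((U g : Matrix κ κ R)ᴴ * e (τ g (τ h m)) * (U g : Matrix κ κ R)) *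
          ((U h : Matrix κ κ R) * (U h : Matrix κ κ R)ᴴ) := by simp only [Matrix.mul_assoc]
    _ = _ := by rw [hU, Matrix.one_mul, Matrix.mul_one]

theorem symmetrization_restricted_class
    {n M : ℕ} {G : Type} [Group G] [Fintype G]
    (U : G →* Matrix.unitaryGroup (Fin n) ℂ)
    (τ : G →* Equiv.Perm (Fin M))
    (ℳ : Set (Fin M → Matrix (Fin n) (Fin n) ℂ))
    (hℳ_povm : ∀ e ∈ ℳ, (∀ m, (e m).PosSemidef) ∧ ∑ m, e m = 1)
    (hℳ_convex : ∀ e ∈ ℳ, ∀ e' ∈ ℳ, ∀ p : ℝ, 0 ≤ p → p ≤ 1 →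
      (fun m => p • e m + (1 - p) • e' m) ∈ ℳ)
    (hℳ_perm : ∀ (σ : Equiv.Perm (Fin M)), ∀ e ∈ ℳ, (fun m => e (σ m)) ∈ ℳ)
    (hℳ_unitary : ∀ (g : G), ∀ e ∈ ℳ,
      (fun m => ((U g : Matrix (Fin n) (Fin n) ℂ))ᴴ * e m *
        (U g : Matrix (Fin n) (Fin n) ℂ)) ∈ ℳ)
    (ρ : Fin M → Matrix (Fin n) (Fin n) ℂ)
    (hρ_pos : ∀ m, (ρ m).PosSemidef)
    (hρ_tr : ∑ m, (ρ m).trace = 1)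
    (hρ_cov : ∀ (g : G) (m : Fin M),
      ρ (τ g m) = (U g : Matrix (Fin n) (Fin n) ℂ) * ρ m *
        ((U g : Matrix (Fin n) (Fin n) ℂ))ᴴ)
    (e : Fin M → Matrix (Fin n) (Fin n) ℂ)
    (he : e ∈ ℳ)
    (eSym : Fin M → Matrix (Fin n) (Fin n) ℂ)
    (heSym : ∀ m, eSym m = ((Fintype.card G : ℂ))⁻¹ •
      ∑ g : G, ((U g : Matrix (Fin n) (Fin n) ℂ))ᴴ * e (τ g m) *
        (U g : Matrix (Fin n) (Fin n) ℂ)) :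
    eSym ∈ ℳ ∧
    (∀ m, (eSym m).PosSemidef) ∧ (∑ m, eSym m = 1) ∧
    (∀ (g : G) (m : Fin M),
      eSym (τ g m) = (U g : Matrix (Fin n) (Fin n) ℂ) * eSym m *
        ((U g : Matrix (Fin n) (Fin n) ℂ))ᴴ) ∧
    (∑ m, (ρ m * eSym m).trace).re = (∑ m, (ρ m * e m).trace).re := by
  have hconv : Convex ℝ ℳ := by
    intro a ha b hb p q hp hq hpq
    obtain rfl : q = 1 - p := by linarith
    exact hℳ_convex a ha b hb p hp (by linarith)
  have hcard : (Fintype.card G : ℂ) ≠ 0 := Nat.cast_ne_zero.mpr Fintype.card_ne_zero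
  have hmem : eSym ∈ ℳ := by
    have hsum := hconv.sum_mem (t := Finset.univ) (w := fun _ : G => (Fintype.card G : ℝ)⁻¹)
      (fun _ _ => by positivity) (by simp)
      (fun g _ => hℳ_unitary g _ (hℳ_perm (τ g) e he))
    convert hsum using 1
    funext m
    rw [heSym, ← Finset.smul_sum, Pi.smul_apply, Finset.sum_apply, ← Complex.coe_smul]
    simp
  obtain ⟨hpos, hone⟩ := hℳ_povm eSym hmem
  refine ⟨hmem, hpos, hone, fun g m => ?_, ?_⟩
  · rw [heSym, heSym, sum_conj_perm_covariant, Matrix.mul_smul, Matrix.smul_mul]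
  · congr 1
    simp only [heSym, Matrix.mul_smul, Finset.mul_sum, Matrix.trace_smul, Matrix.trace_sum,
      ← Finset.smul_sum]
    rw [Finset.sum_comm, Finset.sum_congr rfl fun g _ =>
      sum_trace_mul_conj_perm _ (τ g) ρ e (hρ_cov g)]
    simp [hcard]
end

section
/- (Corollary 1, quantum instantiation.) Let ρ be a covariant ensemble. Then there exists a covariant POVM e◇ that is a minimum-error measurement, i.e., P_S(e, ρ) ≤ P_S(e◇, ρ) for every POVM e. -/
open Matrix ComplexOrder

open scoped MatrixOrder Matrix.Norms.L2Operator in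
theorem isCompact_setOf_povm {ι n : Type*} [Fintype ι] [Fintype n] [DecidableEq n] :
    IsCompact {e : ι → Matrix n n ℂ | (∀ m, (e m).PosSemidef) ∧ ∑ m, e m = 1} := by
  have : ProperSpace (Matrix n n ℂ) := FiniteDimensional.proper ℂ _
  refine (isCompact_univ_pi fun _ : ι => isCompact_closedBall (0 : Matrix n n ℂ) 1).of_isClosed_subset
    ?_ ?_
  · simp only [← Matrix.nonneg_iff_posSemidef]
    refine .inter (s₁ := {e : ι → Matrix n n ℂ | ∀ m, 0 ≤ e m}) ?_ ?_
    · simp only [Set.ofPred_forall]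
      exact isClosed_iInter fun m => isClosed_le continuous_const (continuous_apply m)
    · exact isClosed_eq (continuous_finsetSum _ fun m _ => continuous_apply m) continuous_const
  · rintro e ⟨hpos, hsum⟩ m -
    simp only [← Matrix.nonneg_iff_posSemidef] at hpos
    rw [mem_closedBall_zero_iff, CStarAlgebra.norm_le_one_iff_of_nonneg _ (hpos m), ← hsum]
    exact Finset.single_le_sum (fun i _ => hpos i) (Finset.mem_univ m)

theorem exists_maximal_povm {ι n : Type*} [Fintype ι] [Fintype n] [DecidableEq n]
    [Nonempty ι] (ρ : ι → Matrix n n ℂ) :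
    ∃ e : ι → Matrix n n ℂ, ((∀ m, (e m).PosSemidef) ∧ ∑ m, e m = 1) ∧
      ∀ e' : ι → Matrix n n ℂ, (∀ m, (e' m).PosSemidef) → ∑ m, e' m = 1 →
        (∑ m, (ρ m * e' m).trace).re ≤ (∑ m, (ρ m * e m).trace).re := by
  classical
  obtain ⟨i⟩ := ‹Nonempty ι›
  obtain ⟨e, he, hmax⟩ := isCompact_setOf_povm.exists_isMaxOn
    (f := fun e : ι → Matrix n n ℂ => (∑ m, (ρ m * e m).trace).re)
    ⟨Pi.single i 1, fun m => by
      by_cases h : m = i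
      · subst h; simpa using Matrix.PosSemidef.one
      · simpa [h] using Matrix.PosSemidef.zero, by simp⟩ (by fun_prop)
  exact ⟨e, he, fun e' hpos hsum => hmax ⟨hpos, hsum⟩⟩

section CovariantAverage

variable {ι n G : Type*} [Group G] [Fintype G] [Fintype n] [DecidableEq n]

/-- The group average of a family of matrices, which is covariant by construction. -/
noncomputable def covariantAverage (U : G →* Matrix.unitaryGroup n ℂ) (τ : G →* Equiv.Perm ι)
    (e : ι → Matrix n n ℂ) (m : ι) : Matrix n n ℂ :=
  (Fintype.card G : ℂ)⁻¹ • ∑ g, (U g : Matrix n n ℂ)ᴴ * e (τ g m) * (U g : Matrix n n ℂ)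

variable (U : G →* Matrix.unitaryGroup n ℂ) (τ : G →* Equiv.Perm ι)

theorem posSemidef_covariantAverage {e : ι → Matrix n n ℂ} (he : ∀ m, (e m).PosSemidef) (m : ι) :
    (covariantAverage U τ e m).PosSemidef :=
  (Matrix.posSemidef_sum _ fun g _ => (he (τ g m)).conjTranspose_mul_mul_same _).smul
    (by positivity)

theorem sum_covariantAverage [Fintype ι] {e : ι → Matrix n n ℂ} (he : ∑ m, e m = 1) :
    ∑ m, covariantAverage U τ e m = 1 := by
  have key (g : G) : ∑ m, (U g : Matrix n n ℂ)ᴴ * e (τ g m) * (U g : Matrix n n ℂ) = 1 := by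
    rw [← Finset.sum_mul, ← Finset.mul_sum, Equiv.sum_comp (τ g) e, he, mul_one]
    exact Matrix.UnitaryGroup.star_mul_self (U g)
  simp only [covariantAverage]
  rw [← Finset.smul_sum, Finset.sum_comm]
  simp only [key, Finset.sum_const, Finset.card_univ]
  rw [← Nat.cast_smul_eq_nsmul ℂ, inv_smul_smul₀ (by simp)]

theorem covariantAverage_apply_perm (e : ι → Matrix n n ℂ) (h : G) (m : ι) :
    covariantAverage U τ e (τ h m) =
      (U h : Matrix n n ℂ) * covariantAverage U τ e m * (U h : Matrix n n ℂ)ᴴ := by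
  have hU : (U h : Matrix n n ℂ) * (U h : Matrix n n ℂ)ᴴ = 1 :=
    Unitary.coe_mul_star_self (U h)
  simp only [covariantAverage]
  rw [Matrix.mul_smul, Matrix.smul_mul, Finset.mul_sum, Finset.sum_mul]
  congr 1
  refine Fintype.sum_equiv (Equiv.mulRight h) _ _ fun g => ?_
  simp only [Equiv.coe_mulRight, map_mul, Equiv.Perm.mul_apply, Matrix.UnitaryGroup.mul_val,
    Matrix.conjTranspose_mul]
  calc _ = ((U h : Matrix n n ℂ) * (U h : Matrix n n ℂ)ᴴ) * ((U g : Matrix n n ℂ)ᴴ *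
        e (τ g (τ h m)) * (U g : Matrix n n ℂ)) * ((U h : Matrix n n ℂ) * (U h : Matrix n n ℂ)ᴴ) := by
        rw [hU, one_mul, mul_one]
    _ = _ := by simp only [mul_assoc]

theorem sum_trace_mul_covariantAverage [Fintype ι] {ρ : ι → Matrix n n ℂ}
    (hρ : ∀ g m, ρ (τ g m) = (U g : Matrix n n ℂ) * ρ m * (U g : Matrix n n ℂ)ᴴ)
    (e : ι → Matrix n n ℂ) :
    ∑ m, (ρ m * covariantAverage U τ e m).trace = ∑ m, (ρ m * e m).trace := by
  have key (g : G) : ∑ m, (ρ m * ((U g : Matrix n n ℂ)ᴴ * e (τ g m) * (U g : Matrix n n ℂ))).trace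
      = ∑ m, (ρ m * e m).trace := by
    rw [← Equiv.sum_comp (τ g) fun m => (ρ m * e m).trace]
    refine Finset.sum_congr rfl fun m _ => ?_
    rw [hρ, ← mul_assoc, Matrix.trace_mul_comm]
    simp only [mul_assoc]
  simp only [covariantAverage, Matrix.mul_smul, Matrix.trace_smul, Finset.mul_sum,
    Matrix.trace_sum]
  simp only [← Finset.mul_sum, smul_eq_mul]
  rw [Finset.sum_comm]
  simp [key]

end CovariantAverage

theorem exists_covariant_minimum_error_measurement
    {n M : ℕ} (hM : 1 ≤ M) {G : Type} [Group G] [Fintype G]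
    (U : G →* Matrix.unitaryGroup (Fin n) ℂ)
    (τ : G →* Equiv.Perm (Fin M))
    (ρ : Fin M → Matrix (Fin n) (Fin n) ℂ)
    (hρ_pos : ∀ m, (ρ m).PosSemidef)
    (hρ_tr : ∑ m, (ρ m).trace = 1)
    (hρ_cov : ∀ (g : G) (m : Fin M),
      ρ (τ g m) = (U g : Matrix (Fin n) (Fin n) ℂ) * ρ m *
        ((U g : Matrix (Fin n) (Fin n) ℂ))ᴴ) :
    ∃ eSym : Fin M → Matrix (Fin n) (Fin n) ℂ,
      (∀ m, (eSym m).PosSemidef) ∧ (∑ m, eSym m = 1) ∧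
      (∀ (g : G) (m : Fin M),
        eSym (τ g m) = (U g : Matrix (Fin n) (Fin n) ℂ) * eSym m *
          ((U g : Matrix (Fin n) (Fin n) ℂ))ᴴ) ∧
      (∀ e : Fin M → Matrix (Fin n) (Fin n) ℂ,
        (∀ m, (e m).PosSemidef) → (∑ m, e m = 1) →
        (∑ m, (ρ m * e m).trace).re ≤ (∑ m, (ρ m * eSym m).trace).re) := by
  have : Nonempty (Fin M) := ⟨⟨0, hM⟩⟩
  obtain ⟨e, ⟨hpos, hsum⟩, hmax⟩ := exists_maximal_povm ρ
  refine ⟨covariantAverage U τ e, posSemidef_covariantAverage U τ hpos,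
    sum_covariantAverage U τ hsum, covariantAverage_apply_perm U τ e, ?_⟩
  rwa [sum_trace_mul_covariantAverage U τ hρ_cov]
end

section
/- (Corollary 2 for separable measurements, quantum instantiation.) Let V : G →* Matrix.unitaryGroup (Fin a) ℂ and W : G →* Matrix.unitaryGroup (Fin b) ℂ be group homomorphisms and set U g := (V g) ⊗ₖ (W g), a unitary matrix indexed by Fin a × Fin b. Let ρ be an ensemble on the bipartite system that is covariant (ρ (τ g m) = (U g) * ρ m * (U g)ᴴ for all g, m) and let e be a separable POVM. Then the symmetrization e◇ defined by e◇ m := ((Fintype.card G : ℂ))⁻¹ • ∑ g : G, (U g)ᴴ * e (τ g m) * (U g) is a separable POVM, is covariant (e◇ (τ g m) = (U g) * e◇ m * (U g)ᴴ for all g, m), and satisfies P_S(e◇, ρ) = P_S(e, ρ). -/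
open Matrix ComplexOrder Kronecker

/-- A matrix on the bipartite system `Fin a × Fin b` is separable if it is a finite
sum of Kronecker products of positive semidefinite matrices. -/
def Matrix.IsSeparable {a b : ℕ} (E : Matrix (Fin a × Fin b) (Fin a × Fin b) ℂ) : Prop :=
  ∃ (ι : Type) (_ : Fintype ι) (A : ι → Matrix (Fin a) (Fin a) ℂ)
    (B : ι → Matrix (Fin b) (Fin b) ℂ),
    (∀ i, (A i).PosSemidef) ∧ (∀ i, (B i).PosSemidef) ∧ E = ∑ i, (A i) ⊗ₖ (B i)

namespace Matrix.IsSeparable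

variable {a b : ℕ} {E : Matrix (Fin a × Fin b) (Fin a × Fin b) ℂ}

theorem sum {κ : Type} [Fintype κ] {F : κ → Matrix (Fin a × Fin b) (Fin a × Fin b) ℂ}
    (hF : ∀ k, (F k).IsSeparable) : (∑ k, F k).IsSeparable := by
  choose ι hι A B hA hB h using hF
  refine ⟨Σ k, ι k, inferInstance, fun x => A x.1 x.2, fun x => B x.1 x.2,
    fun x => hA _ _, fun x => hB _ _, ?_⟩
  rw [Fintype.sum_sigma]
  exact Finset.sum_congr rfl fun k _ => h k

theorem smul {c : ℂ} (hc : 0 ≤ c) (hE : E.IsSeparable) : (c • E).IsSeparable := by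
  obtain ⟨ι, hι, A, B, hA, hB, rfl⟩ := hE
  refine ⟨ι, hι, fun i => c • A i, B, fun i => (hA i).smul hc, hB, ?_⟩
  simp only [Finset.smul_sum, smul_kronecker]

theorem conjTranspose_mul_mul_same (hE : E.IsSeparable) (S : Matrix (Fin a) (Fin a) ℂ)
    (T : Matrix (Fin b) (Fin b) ℂ) : ((S ⊗ₖ T)ᴴ * E * (S ⊗ₖ T)).IsSeparable := by
  obtain ⟨ι, hι, A, B, hA, hB, rfl⟩ := hE
  refine ⟨ι, hι, fun i => Sᴴ * A i * S, fun i => Tᴴ * B i * T,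
    fun i => (hA i).conjTranspose_mul_mul_same S,
    fun i => (hB i).conjTranspose_mul_mul_same T, ?_⟩
  simp only [Finset.mul_sum, Finset.sum_mul, conjTranspose_kronecker, mul_kronecker_mul]

end Matrix.IsSeparable

theorem symmetrization_of_separable_povm
    {a b M : ℕ} {G : Type} [Group G] [Fintype G]
    (V : G →* Matrix.unitaryGroup (Fin a) ℂ)
    (W : G →* Matrix.unitaryGroup (Fin b) ℂ)
    (τ : G →* Equiv.Perm (Fin M))
    (U : G → Matrix (Fin a × Fin b) (Fin a × Fin b) ℂ)
    (hU : ∀ g, U g = (V g : Matrix (Fin a) (Fin a) ℂ) ⊗ₖ (W g : Matrix (Fin b) (Fin b) ℂ))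
    (ρ : Fin M → Matrix (Fin a × Fin b) (Fin a × Fin b) ℂ)
    (hρ_pos : ∀ m, (ρ m).PosSemidef)
    (hρ_tr : ∑ m, (ρ m).trace = 1)
    (hρ_cov : ∀ (g : G) (m : Fin M), ρ (τ g m) = U g * ρ m * (U g)ᴴ)
    (e : Fin M → Matrix (Fin a × Fin b) (Fin a × Fin b) ℂ)
    (he_pos : ∀ m, (e m).PosSemidef)
    (he_sum : ∑ m, e m = 1)
    (he_sep : ∀ m, (e m).IsSeparable)
    (eSym : Fin M → Matrix (Fin a × Fin b) (Fin a × Fin b) ℂ)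
    (heSym : ∀ m, eSym m = ((Fintype.card G : ℂ))⁻¹ •
      ∑ g : G, (U g)ᴴ * e (τ g m) * (U g)) :
    (∀ m, (eSym m).PosSemidef) ∧ (∑ m, eSym m = 1) ∧
    (∀ m, (eSym m).IsSeparable) ∧
    (∀ (g : G) (m : Fin M), eSym (τ g m) = U g * eSym m * (U g)ᴴ) ∧
    (∑ m, (ρ m * eSym m).trace).re = (∑ m, (ρ m * e m).trace).re := by
  have hc : (0 : ℂ) ≤ (Fintype.card G : ℂ)⁻¹ := by positivity
  have hcard : (Fintype.card G : ℂ) ≠ 0 := Nat.cast_ne_zero.mpr Fintype.card_ne_zero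
  have hU_star (g : G) : (U g)ᴴ * U g = 1 := by
    rw [hU, conjTranspose_kronecker, ← mul_kronecker_mul, ← star_eq_conjTranspose,
      ← star_eq_conjTranspose, Unitary.coe_star_mul_self, Unitary.coe_star_mul_self,
      one_kronecker_one]
  have hU_mul (g h : G) : U (g * h) = U g * U h := by
    simp only [hU, map_mul, Submonoid.coe_mul, mul_kronecker_mul]
  have hU_star' (g : G) : U g * (U g)ᴴ = 1 := mul_eq_one_comm.mp (hU_star g)
  have hpos (m : Fin M) : (eSym m).PosSemidef := by
    rw [heSym]
    exact (posSemidef_sum _ fun g _ => (he_pos _).conjTranspose_mul_mul_same (U g)).smul hc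
  refine ⟨hpos, ?_, fun m => ?_, fun h m => ?_, ?_⟩
  · have hterm (g : G) : ∑ m, (U g)ᴴ * e (τ g m) * U g = 1 := by
      rw [← Finset.sum_mul, ← Finset.mul_sum, Equiv.sum_comp (τ g) e, he_sum, mul_one, hU_star]
    simp only [heSym]
    rw [← Finset.smul_sum, Finset.sum_comm, Finset.sum_congr rfl fun g _ => hterm g,
      Finset.sum_const, Finset.card_univ, ← Nat.cast_smul_eq_nsmul ℂ, inv_smul_smul₀ hcard]
  · rw [heSym]
    refine (Matrix.IsSeparable.sum fun g => ?_).smul hc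
    rw [hU]
    exact (he_sep _).conjTranspose_mul_mul_same _ _
  · rw [heSym, heSym, mul_smul_comm, smul_mul_assoc, Finset.mul_sum, Finset.sum_mul,
      ← Equiv.sum_comp (Equiv.mulRight h) fun g => U h * ((U g)ᴴ * e (τ g m) * U g) * (U h)ᴴ]
    congr 1
    refine Finset.sum_congr rfl fun g _ => ?_
    calc (U g)ᴴ * e (τ g (τ h m)) * U g
        = (U h * (U h)ᴴ) * (U g)ᴴ * e (τ g (τ h m)) * U g * (U h * (U h)ᴴ) := by
          rw [hU_star', one_mul, mul_one]
      _ = U h * ((U (g * h))ᴴ * e (τ (g * h) m) * U (g * h)) * (U h)ᴴ := by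
          simp only [hU_mul, conjTranspose_mul, map_mul, Equiv.Perm.mul_apply, mul_assoc]
  · have hterm (g : G) :
        ∑ m, (ρ m * ((U g)ᴴ * e (τ g m) * U g)).trace = ∑ m, (ρ m * e m).trace := by
      rw [← Equiv.sum_comp (τ g) fun m => (ρ m * e m).trace]
      refine Finset.sum_congr rfl fun m _ => ?_
      rw [hρ_cov, ← mul_assoc, trace_mul_comm]
      simp only [mul_assoc]
    congr 1
    simp only [heSym, mul_smul_comm, trace_smul, Finset.mul_sum, trace_sum]
    rw [← Finset.smul_sum, Finset.sum_comm, Finset.sum_congr rfl fun g _ => hterm g,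
      Finset.sum_const, Finset.card_univ, ← Nat.cast_smul_eq_nsmul ℂ, inv_smul_smul₀ hcard]
end

section
/- (Corollary 2 for sequential measurements, quantum instantiation.) Let V : G →* Matrix.unitaryGroup (Fin a) ℂ and W : G →* Matrix.unitaryGroup (Fin b) ℂ be group homomorphisms and set U g := (V g) ⊗ₖ (W g). Let ρ be an ensemble on the bipartite system that is covariant (ρ (τ g m) = (U g) * ρ m * (U g)ᴴ for all g, m) and let e be a sequential POVM. Then the symmetrization e◇ defined by e◇ m := ((Fintype.card G : ℂ))⁻¹ • ∑ g : G, (U g)ᴴ * e (τ g m) * (U g) is a sequential POVM, is covariant (e◇ (τ g m) = (U g) * e◇ m * (U g)ᴴ for all g, m), and satisfies P_S(e◇, ρ) = P_S(e, ρ). -/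
open Matrix ComplexOrder Kronecker

/-- A POVM `e` on the bipartite system `Fin a × Fin b` is sequential if it arises from
first measuring the `Fin a` factor and then, conditioned on the outcome, measuring
the `Fin b` factor. -/
def IsSequentialPOVM {a b M : ℕ}
    (e : Fin M → Matrix (Fin a × Fin b) (Fin a × Fin b) ℂ) : Prop :=
  ∃ (ι : Type) (_ : Fintype ι) (A : ι → Matrix (Fin a) (Fin a) ℂ)
    (B : ι → Fin M → Matrix (Fin b) (Fin b) ℂ),
    (∀ i, (A i).PosSemidef) ∧ (∑ i, A i = 1) ∧
    (∀ i m, (B i m).PosSemidef) ∧ (∀ i, ∑ m, B i m = 1) ∧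
    (∀ m, e m = ∑ i, (A i) ⊗ₖ (B i m))

section Symmetrization

variable {n : Type*} [Fintype n] [DecidableEq n] {M : ℕ} {G : Type*} [Group G]

/-- The tensor product of two finite-dimensional unitary representations. -/
noncomputable def kroneckerUnitary {k l : Type*} [Fintype k] [DecidableEq k] [Fintype l]
    [DecidableEq l] (V : G →* Matrix.unitaryGroup k ℂ) (W : G →* Matrix.unitaryGroup l ℂ) :
    G →* Matrix.unitaryGroup (k × l) ℂ where
  toFun g := ⟨(V g : Matrix k k ℂ) ⊗ₖ (W g : Matrix l l ℂ),
    kronecker_mem_unitary (V g).2 (W g).2⟩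
  map_one' := Subtype.ext (by simp)
  map_mul' g h := Subtype.ext (by simp [mul_kronecker_mul])

theorem unitaryGroup_conjTranspose_mul_self (u : Matrix.unitaryGroup n ℂ) :
    (u : Matrix n n ℂ)ᴴ * u = 1 :=
  Unitary.coe_star_mul_self u

theorem unitaryGroup_mul_conjTranspose_self (u : Matrix.unitaryGroup n ℂ) :
    (u : Matrix n n ℂ) * (u : Matrix n n ℂ)ᴴ = 1 :=
  Unitary.coe_mul_star_self u

variable [Fintype G]

/-- The average of a family of matrices over the action of a finite group that conjugates by
`U g` and permutes the indices by `τ g`. -/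
noncomputable def symmetrization (U : G →* Matrix.unitaryGroup n ℂ)
    (τ : G →* Equiv.Perm (Fin M)) (e : Fin M → Matrix n n ℂ) (m : Fin M) : Matrix n n ℂ :=
  ((Fintype.card G : ℂ))⁻¹ • ∑ g : G, (U g : Matrix n n ℂ)ᴴ * e (τ g m) * (U g : Matrix n n ℂ)

variable (U : G →* Matrix.unitaryGroup n ℂ) (τ : G →* Equiv.Perm (Fin M))

theorem inv_card_smul_sum_const {E : Type*} [AddCommGroup E] [Module ℂ E] (x : E) :
    ((Fintype.card G : ℂ))⁻¹ • ∑ _g : G, x = x := by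
  rw [Finset.sum_const, Finset.card_univ, ← Nat.cast_smul_eq_nsmul ℂ,
    inv_smul_smul₀ (Nat.cast_ne_zero.mpr Fintype.card_ne_zero)]

theorem symmetrization_posSemidef {e : Fin M → Matrix n n ℂ} (he : ∀ m, (e m).PosSemidef)
    (m : Fin M) : (symmetrization U τ e m).PosSemidef :=
  (posSemidef_sum _ fun _ _ => (he _).conjTranspose_mul_mul_same _).smul
    (inv_nonneg.mpr (Nat.cast_nonneg _))

theorem sum_symmetrization {e : Fin M → Matrix n n ℂ} (he : ∑ m, e m = 1) :
    ∑ m, symmetrization U τ e m = 1 := by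
  simp only [symmetrization]
  rw [← Finset.smul_sum, Finset.sum_comm]
  have (g : G) : ∑ m, (U g : Matrix n n ℂ)ᴴ * e (τ g m) * (U g : Matrix n n ℂ) = 1 := by
    rw [← Finset.sum_mul, ← Finset.mul_sum, Equiv.sum_comp (τ g) e, he, mul_one,
      unitaryGroup_conjTranspose_mul_self]
  simp only [this, inv_card_smul_sum_const]

theorem symmetrization_covariant (e : Fin M → Matrix n n ℂ) (g : G) (m : Fin M) :
    symmetrization U τ e (τ g m) =
      (U g : Matrix n n ℂ) * symmetrization U τ e m * (U g : Matrix n n ℂ)ᴴ := by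
  simp only [symmetrization]
  rw [eq_comm, mul_smul_comm, smul_mul_assoc, Finset.mul_sum, Finset.sum_mul,
    ← Equiv.sum_comp (Equiv.mulRight g)]
  congr 1
  refine Finset.sum_congr rfl fun h _ => ?_
  have hl : (U g : Matrix n n ℂ) * (U (h * g) : Matrix n n ℂ)ᴴ = (U h : Matrix n n ℂ)ᴴ := by
    rw [map_mul, Submonoid.coe_mul, conjTranspose_mul, ← mul_assoc,
      unitaryGroup_mul_conjTranspose_self, one_mul]
  have hr : (U (h * g) : Matrix n n ℂ) * (U g : Matrix n n ℂ)ᴴ = U h := by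
    rw [map_mul, Submonoid.coe_mul, mul_assoc, unitaryGroup_mul_conjTranspose_self, mul_one]
  simp only [Equiv.coe_mulRight, ← mul_assoc, hl]
  rw [mul_assoc _ (U (h * g) : Matrix n n ℂ), hr, map_mul, Equiv.Perm.mul_apply]

theorem sum_trace_mul_symmetrization {ρ : Fin M → Matrix n n ℂ}
    (hρ : ∀ g m, ρ (τ g m) = (U g : Matrix n n ℂ) * ρ m * (U g : Matrix n n ℂ)ᴴ)
    (e : Fin M → Matrix n n ℂ) :
    ∑ m, (ρ m * symmetrization U τ e m).trace = ∑ m, (ρ m * e m).trace := by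
  have key (g : G) (m : Fin M) :
      (ρ m * ((U g : Matrix n n ℂ)ᴴ * e (τ g m) * (U g : Matrix n n ℂ))).trace =
        (ρ (τ g m) * e (τ g m)).trace := by
    rw [hρ, ← mul_assoc, trace_mul_comm]
    simp only [mul_assoc]
  simp only [symmetrization, mul_smul_comm, Finset.mul_sum, trace_smul, trace_sum, key]
  rw [← Finset.smul_sum, Finset.sum_comm]
  have (g : G) : ∑ m, (ρ (τ g m) * e (τ g m)).trace = ∑ m, (ρ m * e m).trace :=
    Equiv.sum_comp (τ g) fun m => (ρ m * e m).trace
  simp only [this, inv_card_smul_sum_const]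

end Symmetrization

/-- The symmetrized measurement is again sequential: the first party draws `g` uniformly at
random and measures in the frame rotated by `V g`, and the second party, who learns `g`,
measures in the frame rotated by `W g`. -/
theorem IsSequentialPOVM.symmetrization {a b M : ℕ} {G : Type} [Group G] [Fintype G]
    (V : G →* Matrix.unitaryGroup (Fin a) ℂ) (W : G →* Matrix.unitaryGroup (Fin b) ℂ)
    (τ : G →* Equiv.Perm (Fin M)) {e : Fin M → Matrix (Fin a × Fin b) (Fin a × Fin b) ℂ}
    (he : IsSequentialPOVM e) :
    IsSequentialPOVM (symmetrization (kroneckerUnitary V W) τ e) := by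
  obtain ⟨ι, _, A, B, hA, hA_sum, hB, hB_sum, he⟩ := he
  refine ⟨G × ι, inferInstance,
    fun p => ((Fintype.card G : ℂ))⁻¹ •
      ((V p.1 : Matrix (Fin a) (Fin a) ℂ)ᴴ * A p.2 * (V p.1 : Matrix (Fin a) (Fin a) ℂ)),
    fun p m => (W p.1 : Matrix (Fin b) (Fin b) ℂ)ᴴ * B p.2 (τ p.1 m) *
      (W p.1 : Matrix (Fin b) (Fin b) ℂ),
    fun p => ((hA _).conjTranspose_mul_mul_same _).smul (inv_nonneg.mpr (Nat.cast_nonneg _)),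
    ?_, fun p m => (hB _ _).conjTranspose_mul_mul_same _, fun p => ?_, fun m => ?_⟩
  · rw [← Finset.smul_sum, Fintype.sum_prod_type]
    simp only [← Finset.sum_mul, ← Finset.mul_sum, hA_sum, mul_one,
      unitaryGroup_conjTranspose_mul_self, inv_card_smul_sum_const]
  · rw [← Finset.sum_mul, ← Finset.mul_sum, Equiv.sum_comp (τ p.1) (B p.2), hB_sum, mul_one,
      unitaryGroup_conjTranspose_mul_self]
  · simp only [_root_.symmetrization, kroneckerUnitary, MonoidHom.coe_mk, OneHom.coe_mk, he,
      smul_kronecker, mul_kronecker_mul, ← conjTranspose_kronecker, Finset.mul_sum,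
      Finset.sum_mul, ← Finset.smul_sum, Fintype.sum_prod_type]

theorem symmetrization_of_sequential_povm
    {a b M : ℕ} {G : Type} [Group G] [Fintype G]
    (V : G →* Matrix.unitaryGroup (Fin a) ℂ)
    (W : G →* Matrix.unitaryGroup (Fin b) ℂ)
    (τ : G →* Equiv.Perm (Fin M))
    (U : G → Matrix (Fin a × Fin b) (Fin a × Fin b) ℂ)
    (hU : ∀ g, U g = (V g : Matrix (Fin a) (Fin a) ℂ) ⊗ₖ (W g : Matrix (Fin b) (Fin b) ℂ))
    (ρ : Fin M → Matrix (Fin a × Fin b) (Fin a × Fin b) ℂ)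
    (hρ_pos : ∀ m, (ρ m).PosSemidef)
    (hρ_tr : ∑ m, (ρ m).trace = 1)
    (hρ_cov : ∀ (g : G) (m : Fin M), ρ (τ g m) = U g * ρ m * (U g)ᴴ)
    (e : Fin M → Matrix (Fin a × Fin b) (Fin a × Fin b) ℂ)
    (he_pos : ∀ m, (e m).PosSemidef)
    (he_sum : ∑ m, e m = 1)
    (he_seq : IsSequentialPOVM e)
    (eSym : Fin M → Matrix (Fin a × Fin b) (Fin a × Fin b) ℂ)
    (heSym : ∀ m, eSym m = ((Fintype.card G : ℂ))⁻¹ •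
      ∑ g : G, (U g)ᴴ * e (τ g m) * (U g)) :
    (∀ m, (eSym m).PosSemidef) ∧ (∑ m, eSym m = 1) ∧
    IsSequentialPOVM eSym ∧
    (∀ (g : G) (m : Fin M), eSym (τ g m) = U g * eSym m * (U g)ᴴ) ∧
    (∑ m, (ρ m * eSym m).trace).re = (∑ m, (ρ m * e m).trace).re := by
  obtain rfl : U = fun g => (kroneckerUnitary V W g : Matrix _ _ ℂ) := funext hU
  obtain rfl : eSym = symmetrization (kroneckerUnitary V W) τ e := funext heSym
  exact ⟨symmetrization_posSemidef _ τ he_pos, sum_symmetrization _ τ he_sum,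
    he_seq.symmetrization V W τ, symmetrization_covariant _ τ e,
    congrArg Complex.re (sum_trace_mul_symmetrization _ τ hρ_cov e)⟩
end

section
/- (Inclusion of separable measurements in partially transformable measurements, quantum instantiation.) Let e be a separable POVM on the bipartite system and let Ψ : Matrix (Fin a) (Fin a) ℂ →ₗ[ℂ] Matrix (Fin a') (Fin a') ℂ be Hermitian-preserving, positive, and unital. Then the family m ↦ (Ψ ⊗ id) (e m) is a POVM on matrices indexed by Fin a' × Fin b: every (Ψ ⊗ id) (e m) is positive semidefinite and ∑ m, (Ψ ⊗ id) (e m) = 1. -/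
open Matrix ComplexOrder Kronecker

/-- `(Ψ ⊗ id) E`: the map `Ψ` applied on the first tensor factor. The
`((i',k),(j',l))` entry is `(Ψ E^{(k,l)}) i' j'`, where `E^{(k,l)} i j = E (i,k) (j,l)`. -/
def partialMap {a a' b : ℕ}
    (Ψ : Matrix (Fin a) (Fin a) ℂ →ₗ[ℂ] Matrix (Fin a') (Fin a') ℂ)
    (E : Matrix (Fin a × Fin b) (Fin a × Fin b) ℂ) :
    Matrix (Fin a' × Fin b) (Fin a' × Fin b) ℂ :=
  Matrix.of fun p q => Ψ (Matrix.of fun i j => E (i, p.2) (j, q.2)) p.1 q.1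

theorem partialMap_sum {a a' b : ℕ} {ι : Type*} (s : Finset ι)
    (Ψ : Matrix (Fin a) (Fin a) ℂ →ₗ[ℂ] Matrix (Fin a') (Fin a') ℂ)
    (E : ι → Matrix (Fin a × Fin b) (Fin a × Fin b) ℂ) :
    partialMap Ψ (∑ m ∈ s, E m) = ∑ m ∈ s, partialMap Ψ (E m) := by
  ext p q
  have h : (Matrix.of fun i j => (∑ m ∈ s, E m) (i, p.2) (j, q.2)) =
      ∑ m ∈ s, Matrix.of fun i j => E m (i, p.2) (j, q.2) := by
    ext i j
    simp [Matrix.sum_apply]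
  rw [partialMap, Matrix.of_apply, h, map_sum, Matrix.sum_apply, Matrix.sum_apply]
  rfl

theorem partialMap_kronecker {a a' b : ℕ}
    (Ψ : Matrix (Fin a) (Fin a) ℂ →ₗ[ℂ] Matrix (Fin a') (Fin a') ℂ)
    (A : Matrix (Fin a) (Fin a) ℂ) (B : Matrix (Fin b) (Fin b) ℂ) :
    partialMap Ψ (A ⊗ₖ B) = Ψ A ⊗ₖ B := by
  ext p q
  have h : (Matrix.of fun i j => (A ⊗ₖ B) (i, p.2) (j, q.2)) = B p.2 q.2 • A := by
    ext i j
    simp [Matrix.kroneckerMap_apply, mul_comm]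
  rw [partialMap, Matrix.of_apply, h, map_smul, Matrix.smul_apply, smul_eq_mul,
    Matrix.kroneckerMap_apply, mul_comm]

theorem Matrix.IsSeparable.posSemidef_partialMap {a a' b : ℕ}
    {E : Matrix (Fin a × Fin b) (Fin a × Fin b) ℂ} (hE : E.IsSeparable)
    (Ψ : Matrix (Fin a) (Fin a) ℂ →ₗ[ℂ] Matrix (Fin a') (Fin a') ℂ)
    (hpos : ∀ X : Matrix (Fin a) (Fin a) ℂ, X.PosSemidef → (Ψ X).PosSemidef) :
    (partialMap Ψ E).PosSemidef := by
  obtain ⟨ι, _, A, B, hA, hB, rfl⟩ := hE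
  rw [partialMap_sum]
  refine Matrix.posSemidef_sum _ fun i _ => ?_
  rw [partialMap_kronecker]
  exact (hpos _ (hA i)).kronecker (hB i)

theorem partialMap_of_separable_povm_is_povm {a a' b M : ℕ}
    (e : Fin M → Matrix (Fin a × Fin b) (Fin a × Fin b) ℂ)
    (he_pos : ∀ m, (e m).PosSemidef)
    (he_sum : ∑ m, e m = 1)
    (he_sep : ∀ m, (e m).IsSeparable)
    (Ψ : Matrix (Fin a) (Fin a) ℂ →ₗ[ℂ] Matrix (Fin a') (Fin a') ℂ)
    (hherm : ∀ X : Matrix (Fin a) (Fin a) ℂ, Ψ Xᴴ = (Ψ X)ᴴ)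
    (hpos : ∀ X : Matrix (Fin a) (Fin a) ℂ, X.PosSemidef → (Ψ X).PosSemidef)
    (hunital : Ψ 1 = 1) :
    (∀ m, (partialMap Ψ (e m)).PosSemidef) ∧ ∑ m, partialMap Ψ (e m) = 1 := by
  refine ⟨fun m => (he_sep m).posSemidef_partialMap Ψ hpos, ?_⟩
  rw [← partialMap_sum, he_sum, ← Matrix.one_kronecker_one, partialMap_kronecker, hunital,
    Matrix.one_kronecker_one]
end

section
/- (Claim from the quantum example: automorphisms of the positive semidefinite cone preserve pure (rank-one) elements.) Let Φ : Matrix (Fin n) (Fin n) ℂ →ₗ[ℝ] Matrix (Fin n) (Fin n) ℂ be an ℝ-linear bijection that is Hermitian-preserving (Φ (Xᴴ) = (Φ X)ᴴ for all X) and maps the positive semidefinite cone onto itself, i.e., {Φ X | X positive semidefinite} = {Y | Y positive semidefinite}. Then for every positive semidefinite matrix P of rank one, Φ P is positive semidefinite of rank one. -/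
open Matrix ComplexOrder

namespace Matrix

variable {n : Type*} [Fintype n]

theorem rank_eq_zero_iff {m : Type*} {A : Matrix m n ℂ} : A.rank = 0 ↔ A = 0 := by
  classical
  refine ⟨fun h ↦ ?_, fun h ↦ by simp [h]⟩
  rw [rank, Submodule.finrank_eq_zero, LinearMap.range_eq_bot] at h
  ext i j
  simpa using congrFun (LinearMap.congr_fun h (Pi.single j 1)) i

theorem PosSemidef.mulVec_eq_zero_of_add {A B : Matrix n n ℂ} (hA : A.PosSemidef)
    (hB : B.PosSemidef) {x : n → ℂ} (h : (A + B) *ᵥ x = 0) : A *ᵥ x = 0 := by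
  rw [← (hA.add hB).dotProduct_mulVec_zero_iff, add_mulVec, dotProduct_add] at h
  rw [← hA.dotProduct_mulVec_zero_iff]
  exact ((add_eq_zero_iff_of_nonneg (hA.dotProduct_mulVec_nonneg x)
    (hB.dotProduct_mulVec_nonneg x)).1 h).1

/-- A positive semidefinite matrix of rank one spans an extreme ray of the positive semidefinite
cone. -/
theorem PosSemidef.exists_eq_smul_of_add_rank_eq_one {A B : Matrix n n ℂ} (hA : A.PosSemidef)
    (hB : B.PosSemidef) (hrank : (A + B).rank = 1) : ∃ t : ℝ, A = t • (A + B) := by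
  classical
  have hP := hA.add hB
  have hker (x : n → ℂ) := hA.mulVec_eq_zero_of_add hB (x := x)
  generalize A + B = P at *
  rw [rank, finrank_eq_one_iff'] at hrank
  obtain ⟨⟨_, u, rfl⟩, hu, hspan⟩ := hrank
  have hPu : P *ᵥ u ≠ 0 := fun h ↦ hu (Subtype.ext h)
  have hf (x : n → ℂ) : ∃ c : ℂ, P *ᵥ x = c • P *ᵥ u := by
    obtain ⟨c, hc⟩ := hspan ⟨P *ᵥ x, x, rfl⟩
    exact ⟨c, (congrArg Subtype.val hc).symm⟩
  choose f hf using hf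
  have hAf (x : n → ℂ) : A *ᵥ x = f x • A *ᵥ u := by
    have := hker (x - f x • u) (by rw [mulVec_sub, mulVec_smul, ← hf, sub_self])
    rwa [mulVec_sub, mulVec_smul, sub_eq_zero] at this
  have hsymm {M : Matrix n n ℂ} (hM : M.PosSemidef) (x y : n → ℂ) :
      star x ⬝ᵥ M *ᵥ y = star (star y ⬝ᵥ M *ᵥ x) := by
    rw [← star_dotProduct_star, star_star, star_mulVec, hM.isHermitian.eq, dotProduct_comm,
      ← dotProduct_mulVec, dotProduct_comm]
  obtain ⟨a, ha⟩ : ∃ a : ℝ, star u ⬝ᵥ A *ᵥ u = a :=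
    ⟨_, Complex.eq_re_of_ofReal_le (r := 0) (by simpa using hA.dotProduct_mulVec_nonneg u)⟩
  obtain ⟨p, hp⟩ : ∃ p : ℝ, star u ⬝ᵥ P *ᵥ u = p :=
    ⟨_, Complex.eq_re_of_ofReal_le (r := 0) (by simpa using hP.dotProduct_mulVec_nonneg u)⟩
  have hp0 : (p : ℂ) ≠ 0 := by
    rwa [← hp, Ne, hP.dotProduct_mulVec_zero_iff]
  have key (x : n → ℂ) : star x ⬝ᵥ A *ᵥ u = (a / p : ℂ) * (star x ⬝ᵥ P *ᵥ u) := by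
    rw [hsymm hA, hsymm hP, hAf, hf, dotProduct_smul, dotProduct_smul, ha, hp]
    simp
    field_simp
  have hAu : A *ᵥ u = (a / p : ℂ) • P *ᵥ u := by
    ext i
    simpa using key (Pi.single i 1)
  refine ⟨a / p, ?_⟩
  refine Matrix.ext_of_mulVec_single fun i ↦ ?_
  rw [hAf, smul_mulVec, hf, hAu]
  ext j
  simp
  ring

/-- A nonzero positive semidefinite matrix spanning an extreme ray has rank one. -/
theorem PosSemidef.rank_eq_one_of_extreme {A : Matrix n n ℂ} (hA : A.PosSemidef) (h0 : A ≠ 0)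
    (h : ∀ B C : Matrix n n ℂ, B.PosSemidef → C.PosSemidef → B + C = A → ∃ t : ℝ, B = t • A) :
    A.rank = 1 := by
  classical
  obtain ⟨B, hB⟩ : ∃ B : Matrix n n ℂ, A = Bᴴ * B := by
    open scoped MatrixOrder Matrix.Norms.L2Operator in
    exact CStarAlgebra.nonneg_iff_eq_star_mul_self.mp hA.nonneg
  obtain ⟨i, hi⟩ : ∃ i, Bᴴ * diagonal (Pi.single i 1) * B ≠ 0 := by
    by_contra! hc
    refine h0 ?_
    have hone : (1 : Matrix n n ℂ) = ∑ i, diagonal (Pi.single i 1) := by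
      ext j k
      simp [Matrix.sum_apply, diagonal_apply, one_apply, Pi.single_apply]
    rw [hB, ← mul_one Bᴴ, hone, Finset.mul_sum, Finset.sum_mul]
    exact Finset.sum_eq_zero fun i _ ↦ hc i
  have hle : (Pi.single i 1 : n → ℂ) ≤ 1 := by
    intro j
    by_cases hj : j = i <;> simp [hj]
  obtain ⟨t, ht⟩ := h (Bᴴ * diagonal (Pi.single i 1) * B)
    (Bᴴ * diagonal (1 - Pi.single i 1) * B)
    ((PosSemidef.diagonal (Pi.single_nonneg.2 zero_le_one)).conjTranspose_mul_mul_same B)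
    ((PosSemidef.diagonal (sub_nonneg.2 hle)).conjTranspose_mul_mul_same B)
    (by rw [← add_mul, ← mul_add, diagonal_add]
        simp [hB])
  have ht0 : t ≠ 0 := by
    rintro rfl
    exact hi (by simpa using ht)
  have hAt : A = ((t⁻¹ : ℝ) • (1 : Matrix n n ℂ)) * (Bᴴ * diagonal (Pi.single i 1) * B) := by
    rw [ht, smul_mul_smul_comm, one_mul, inv_mul_cancel₀ ht0, one_smul]
  have hdiag : (diagonal (Pi.single i 1 : n → ℂ)).rank ≤ 1 := by
    rw [rank_diagonal]
    exact Fintype.card_le_one_iff_subsingleton.2 ⟨fun x y ↦ Subtype.ext <| by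
      have hx := x.2
      have hy := y.2
      simp only [Pi.single_apply, ne_eq, ite_eq_right_iff, one_ne_zero, imp_false,
        not_not] at hx hy
      rw [hx, hy]⟩
  have hr : A.rank ≤ 1 := by
    rw [hAt]
    exact (rank_mul_le_right _ _).trans <| (rank_mul_le_left _ _).trans <|
      (rank_mul_le_right _ _).trans hdiag
  exact le_antisymm hr (Nat.one_le_iff_ne_zero.2 (mt rank_eq_zero_iff.1 h0))

end Matrix

theorem cone_automorphism_preserves_rank_one {n : ℕ}
    (Φ : Matrix (Fin n) (Fin n) ℂ →ₗ[ℝ] Matrix (Fin n) (Fin n) ℂ)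
    (hbij : Function.Bijective Φ)
    (hherm : ∀ X : Matrix (Fin n) (Fin n) ℂ, Φ Xᴴ = (Φ X)ᴴ)
    (hcone : Φ '' {X : Matrix (Fin n) (Fin n) ℂ | X.PosSemidef} =
      {Y : Matrix (Fin n) (Fin n) ℂ | Y.PosSemidef})
    (P : Matrix (Fin n) (Fin n) ℂ) (hP : P.PosSemidef) (hrank : P.rank = 1) :
    (Φ P).PosSemidef ∧ (Φ P).rank = 1 := by
  have hΦP : (Φ P).PosSemidef := hcone.subset ⟨P, hP, rfl⟩
  refine ⟨hΦP, hΦP.rank_eq_one_of_extreme ?_ fun B C hB hC hBC ↦ ?_⟩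
  · rw [Ne, map_eq_zero_iff Φ hbij.injective]
    rintro rfl
    simp at hrank
  · obtain ⟨X, hX, rfl⟩ := hcone.superset hB
    obtain ⟨Y, hY, rfl⟩ := hcone.superset hC
    obtain rfl : X + Y = P := hbij.injective (by rw [map_add, hBC])
    obtain ⟨t, ht⟩ := PosSemidef.exists_eq_smul_of_add_rank_eq_one hX hY hrank
    exact ⟨t, by rw [← map_smul, ← ht]⟩
end
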